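/- If a linear map D on 2×2 matrices of the form D(ρ) = Σ_{j,k} K_{jk} (V_k ρ V_j† − ½{V_j† V_k, ρ}) has a Kossakowski matrix K that is not positive semidefinite (for linearly independent traceless V_j), then the generated semigroup e^{tD} is not completely positive; conversely if K is positive semidefinite then each e^{tD} is completely positive. -/

import Mathlib

open Matrix
open scoped ComplexOrder

/-- The extension `Φ ⊗ id_k` of a map on `2×2` matrices to `2k × 2k` matrices. -/
noncomputable def extTensor (Φ : Matrix (Fin 2) (Fin 2) ℂ →ₗ[ℂ] Matrix (Fin 2) (Fin 2) ℂ)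
    (k : ℕ) (M : Matrix (Fin 2 × Fin k) (Fin 2 × Fin k) ℂ) :
    Matrix (Fin 2 × Fin k) (Fin 2 × Fin k) ℂ :=
  Matrix.of fun p q => Φ (Matrix.of fun i j => M (i, p.2) (j, q.2)) p.1 q.1

/-- Complete positivity: `Φ ⊗ id_k` maps positive semidefinite matrices to positive
semidefinite matrices, for every `k`. -/
def IsCompletelyPositive (Φ : Matrix (Fin 2) (Fin 2) ℂ →ₗ[ℂ] Matrix (Fin 2) (Fin 2) ℂ) : Prop :=
  ∀ k : ℕ, ∀ M : Matrix (Fin 2 × Fin k) (Fin 2 × Fin k) ℂ,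
    M.PosSemidef → (extTensor Φ k M).PosSemidef

section ConeInvariance

variable {W : Type*} [NormedAddCommGroup W] [NormedSpace ℝ W] [CompleteSpace W]

/-- The exponential of a nonnegative multiple of an operator preserving a closed cone preserves
the cone. -/
theorem exp_smul_mem_of_mapsTo (C : PointedCone ℝ W) (hC : IsClosed (C : Set W))
    (T : W →L[ℝ] W) (hT : ∀ x ∈ C, T x ∈ C) {r : ℝ} (hr : 0 ≤ r) {x : W} (hx : x ∈ C) :
    NormedSpace.exp (r • T) x ∈ C := by
  have hpow : ∀ n : ℕ, (T ^ n) x ∈ C := by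
    intro n
    induction n with
    | zero => simpa using hx
    | succ n ih => rw [pow_succ']; exact hT _ ih
  have hsum := (NormedSpace.exp_series_hasSum_exp' (𝕂 := ℝ) (r • T)).mapL
    (ContinuousLinearMap.apply ℝ W x)
  refine hC.mem_of_tendsto hsum (Filter.Eventually.of_forall fun s => ?_)
  refine C.sum_mem fun n _ => ?_
  have hnonneg : (0 : ℝ) ≤ (n.factorial : ℝ)⁻¹ * r ^ n := by positivity
  simpa [smul_pow, smul_smul] using
    C.smul_mem hnonneg (hpow n)

/-- If `1 + s A + s² B` preserves a closed cone for all `s > 0`, then so does `exp (t A)`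
for all `t ≥ 0`. -/
theorem exp_smul_mem_of_perturbation (C : PointedCone ℝ W) (hC : IsClosed (C : Set W))
    (A B : W →L[ℝ] W)
    (h : ∀ s : ℝ, 0 < s → ∀ x ∈ C, x + s • A x + s ^ 2 • B x ∈ C)
    {t : ℝ} (ht : 0 ≤ t) {x : W} (hx : x ∈ C) :
    NormedSpace.exp (t • A) x ∈ C := by
  let : NormedAlgebra ℚ (W →L[ℝ] W) := NormedAlgebra.restrictScalars ℚ ℝ _
  have hpos : ∀ s : ℝ, 0 < s → NormedSpace.exp (t • (A + s • B)) x ∈ C := by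
    intro s hs
    set T : W →L[ℝ] W := 1 + s • A + s ^ 2 • B with hT
    have hdecomp : t • (A + s • B) = (t / s) • T + algebraMap ℝ (W →L[ℝ] W) (-(t / s)) := by
      rw [hT, Algebra.algebraMap_eq_smul_one]
      match_scalars <;> field_simp
      ring
    rw [hdecomp, NormedSpace.exp_add_of_commute (Algebra.commute_algebraMap_right _ _),
      ← NormedSpace.algebraMap_exp_comm, ← Real.exp_eq_exp_ℝ, Algebra.algebraMap_eq_smul_one]
    have hmem := C.smul_mem (Real.exp_pos (-(t / s))).le
      (exp_smul_mem_of_mapsTo C hC T (fun y hy => by simpa [hT] using h s hs y hy)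
        (div_nonneg ht hs.le) hx)
    simpa using hmem
  have hcont : Continuous fun s : ℝ => NormedSpace.exp (t • (A + s • B)) x :=
    (ContinuousLinearMap.apply ℝ W x).continuous.comp
      (NormedSpace.exp_continuous.comp (by fun_prop))
  have hlim := (hcont.tendsto 0).mono_left (nhdsWithin_le_nhds (s := Set.Ioi 0))
  simpa using hC.mem_of_tendsto hlim (eventually_mem_nhdsWithin.mono hpos)

/-- A solution of `u' = A u` is given by the exponential of `A`. -/
theorem eq_exp_smul_of_hasDerivAt (A : W →L[ℝ] W) (u : ℝ → W)
    (hu : ∀ t, HasDerivAt u (A (u t)) t) (t : ℝ) :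
    u t = NormedSpace.exp (t • A) (u 0) := by
  have hexp : ∀ s, HasDerivAt (fun s : ℝ => NormedSpace.exp (s • A) (u 0))
      (A (NormedSpace.exp (s • A) (u 0))) s := fun s =>
    (ContinuousLinearMap.apply ℝ W (u 0)).hasFDerivAt.comp_hasDerivAt s
      (hasDerivAt_exp_smul_const' A s)
  exact congrFun (ODE_solution_unique_univ (v := fun _ => A) (s := fun _ => Set.univ) (t₀ := 0)
    (fun _ => A.lipschitz.lipschitzOnWith) (fun s => ⟨hu s, trivial⟩)
    (fun s => ⟨hexp s, trivial⟩) (by simp)) t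

end ConeInvariance

/-- The cone of positive semidefinite complex matrices. -/
def posSemidefCone (n : Type*) [Fintype n] : PointedCone ℝ (Matrix n n ℂ) where
  carrier := {M | M.PosSemidef}
  add_mem' hM hN := hM.add hN
  zero_mem' := Matrix.PosSemidef.zero
  smul_mem' c M hM := by
    have h := Matrix.PosSemidef.smul (a := (c : ℝ)) hM c.2
    exact h

theorem mem_posSemidefCone {n : Type*} [Fintype n] {M : Matrix n n ℂ} :
    M ∈ posSemidefCone n ↔ M.PosSemidef := Iff.rfl

theorem isClosed_posSemidefCone (n : Type*) [Fintype n] :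
    IsClosed (posSemidefCone n : Set (Matrix n n ℂ)) := by
  have h : (posSemidefCone n : Set (Matrix n n ℂ)) =
      {M | Mᴴ = M} ∩ ⋂ x : n → ℂ, {M | 0 ≤ star x ⬝ᵥ (M *ᵥ x)} := by
    ext M
    simp [mem_posSemidefCone, Matrix.posSemidef_iff_dotProduct_mulVec, Matrix.IsHermitian]
  rw [h]
  refine (isClosed_eq (by fun_prop) continuous_id).inter (isClosed_iInter fun x => ?_)
  exact isClosed_le continuous_const (by fun_prop)

/-- `extTensor` as a linear map of the matrix it is applied to. -/
noncomputable def extTensorLinear (Φ : Matrix (Fin 2) (Fin 2) ℂ →ₗ[ℂ] Matrix (Fin 2) (Fin 2) ℂ)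
    (k : ℕ) : Matrix (Fin 2 × Fin k) (Fin 2 × Fin k) ℂ →ₗ[ℝ]
      Matrix (Fin 2 × Fin k) (Fin 2 × Fin k) ℂ where
  toFun := extTensor Φ k
  map_add' M N := by
    ext p q
    exact congrFun₂ (map_add Φ (Matrix.of fun i j => M (i, p.2) (j, q.2))
      (Matrix.of fun i j => N (i, p.2) (j, q.2))) p.1 q.1
  map_smul' c M := by
    ext p q
    exact congrFun₂ (map_smul Φ (c : ℂ) (Matrix.of fun i j => M (i, p.2) (j, q.2))) p.1 q.1

open scoped Matrix.Norms.Elementwise in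
theorem extTensor_posSemidef_of_perturbation
    (D B : Matrix (Fin 2) (Fin 2) ℂ →ₗ[ℂ] Matrix (Fin 2) (Fin 2) ℂ)
    (Λ : ℝ → (Matrix (Fin 2) (Fin 2) ℂ →ₗ[ℂ] Matrix (Fin 2) (Fin 2) ℂ))
    (hΛ0 : Λ 0 = LinearMap.id)
    (hΛode : ∀ ρ, ∀ i j : Fin 2, ∀ t : ℝ,
      HasDerivAt (fun s => (Λ s ρ) i j) ((D (Λ t ρ)) i j) t)
    (h : ∀ s : ℝ, 0 < s →
      IsCompletelyPositive (LinearMap.id + (s : ℂ) • D + ((s : ℂ) ^ 2) • B))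
    {t : ℝ} (ht : 0 ≤ t) : IsCompletelyPositive (Λ t) := by
  intro k M hM
  have hu : ∀ s : ℝ, HasDerivAt (fun s => extTensor (Λ s) k M)
      ((extTensorLinear D k).toContinuousLinearMap (extTensor (Λ s) k M)) s := fun s =>
    hasDerivAt_pi.2 fun p => hasDerivAt_pi.2 fun q =>
      hΛode (Matrix.of fun i j => M (i, p.2) (j, q.2)) p.1 q.1 s
  have h0 : extTensor (Λ 0) k M = M := by
    rw [hΛ0]; rfl
  have hsol := eq_exp_smul_of_hasDerivAt _ _ hu t
  rw [h0] at hsol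
  rw [← mem_posSemidefCone, hsol]
  refine exp_smul_mem_of_perturbation _ (isClosed_posSemidefCone _) _
    (extTensorLinear B k).toContinuousLinearMap (fun s hs N hN => ?_) ht hM
  have hN' := h s hs k N hN
  rw [mem_posSemidefCone]
  convert hN' using 1
  have hB : ((s : ℂ) ^ 2) = ((s ^ 2 : ℝ) : ℂ) := by push_cast; rfl
  rw [hB]
  rfl

theorem IsCompletelyPositive.add
    {Φ Ψ : Matrix (Fin 2) (Fin 2) ℂ →ₗ[ℂ] Matrix (Fin 2) (Fin 2) ℂ}
    (hΦ : IsCompletelyPositive Φ) (hΨ : IsCompletelyPositive Ψ) :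
    IsCompletelyPositive (Φ + Ψ) :=
  fun k M hM => (hΦ k M hM).add (hΨ k M hM)

theorem IsCompletelyPositive.smul
    {Φ : Matrix (Fin 2) (Fin 2) ℂ →ₗ[ℂ] Matrix (Fin 2) (Fin 2) ℂ}
    (hΦ : IsCompletelyPositive Φ) {c : ℂ} (hc : 0 ≤ c) : IsCompletelyPositive (c • Φ) :=
  fun k M hM => (hΦ k M hM).smul hc

theorem IsCompletelyPositive.sum {ι : Type*} (s : Finset ι)
    {Φ : ι → Matrix (Fin 2) (Fin 2) ℂ →ₗ[ℂ] Matrix (Fin 2) (Fin 2) ℂ}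
    (hΦ : ∀ i ∈ s, IsCompletelyPositive (Φ i)) : IsCompletelyPositive (∑ i ∈ s, Φ i) :=
  Finset.sum_induction Φ IsCompletelyPositive (fun _ _ => IsCompletelyPositive.add)
    (fun _ _ _ => Matrix.PosSemidef.zero) hΦ

/-- The map `ρ ↦ A ρ Aᴴ`. -/
noncomputable def krausMap (A : Matrix (Fin 2) (Fin 2) ℂ) :
    Matrix (Fin 2) (Fin 2) ℂ →ₗ[ℂ] Matrix (Fin 2) (Fin 2) ℂ :=
  LinearMap.mulLeftRight ℂ (A, Aᴴ)

theorem krausMap_apply (A ρ : Matrix (Fin 2) (Fin 2) ℂ) : krausMap A ρ = A * ρ * Aᴴ :=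
  LinearMap.mulLeftRight_apply _ _ _

open scoped Kronecker in
theorem isCompletelyPositive_krausMap (A : Matrix (Fin 2) (Fin 2) ℂ) :
    IsCompletelyPositive (krausMap A) := by
  intro k M hM
  convert hM.mul_mul_conjTranspose_same (A ⊗ₖ (1 : Matrix (Fin k) (Fin k) ℂ)) using 1
  ext p q
  simp [extTensor, krausMap_apply, Matrix.mul_apply, Fintype.sum_prod_type, Matrix.one_apply,
    apply_ite, Finset.sum_ite_eq]

/-- A dissipator with Kraus operators `L a` generates completely positive maps to first order. -/
theorem isCompletelyPositive_id_add_dissipator {ι : Type*} [Fintype ι]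
    (L : ι → Matrix (Fin 2) (Fin 2) ℂ)
    (D : Matrix (Fin 2) (Fin 2) ℂ →ₗ[ℂ] Matrix (Fin 2) (Fin 2) ℂ)
    (hD : ∀ ρ, D ρ = ∑ a, (L a * ρ * (L a)ᴴ -
      (1/2 : ℂ) • ((L a)ᴴ * L a * ρ + ρ * ((L a)ᴴ * L a)))) {s : ℝ} (hs : 0 < s) :
    IsCompletelyPositive (LinearMap.id + (s : ℂ) • D +
      ((s : ℂ) ^ 2) • krausMap ((-1/2 : ℂ) • ∑ a, (L a)ᴴ * L a)) := by
  have hsum : IsCompletelyPositive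
      (krausMap (1 + (s : ℂ) • ((-1/2 : ℂ) • ∑ a, (L a)ᴴ * L a)) +
        (s : ℂ) • ∑ a, krausMap (L a)) :=
    (isCompletelyPositive_krausMap _).add
      ((IsCompletelyPositive.sum _ fun a _ => isCompletelyPositive_krausMap (L a)).smul
        (by exact_mod_cast hs.le))
  convert hsum using 1
  refine LinearMap.ext fun ρ => ?_
  have hG : (∑ a, (L a)ᴴ * L a)ᴴ = ∑ a, (L a)ᴴ * L a := by
    simp [Matrix.conjTranspose_sum]
  have hDρ : D ρ = ∑ a, L a * ρ * (L a)ᴴ -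
      (1/2 : ℂ) • ((∑ a, (L a)ᴴ * L a) * ρ + ρ * ∑ a, (L a)ᴴ * L a) := by
    rw [hD, Finset.sum_sub_distrib, ← Finset.smul_sum, Finset.sum_add_distrib,
      Finset.sum_mul, Finset.mul_sum]
  simp only [LinearMap.add_apply, LinearMap.smul_apply, LinearMap.id_apply, hDρ,
    krausMap_apply, LinearMap.sum_apply, Matrix.conjTranspose_add, Matrix.conjTranspose_smul, hG,
    Matrix.conjTranspose_one]
  simp only [add_mul, mul_add, smul_mul_assoc, mul_smul_comm, one_mul, mul_one]
  have h2 : star (-1/2 : ℂ) = -1/2 := by simp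
  have h3 : star (s : ℂ) = s := by simp
  rw [h2, h3]
  match_scalars <;> ring

/-- The dissipator of a Gram matrix `Bᴴ * B` in diagonal form. -/
theorem dissipator_eq_sum_of_gram {m : ℕ} (V : Fin m → Matrix (Fin 2) (Fin 2) ℂ)
    (B : Matrix (Fin m) (Fin m) ℂ) (ρ : Matrix (Fin 2) (Fin 2) ℂ) :
    (∑ j, ∑ k, (Bᴴ * B) j k •
      (V k * ρ * (V j)ᴴ - (1/2 : ℂ) • ((V j)ᴴ * V k * ρ + ρ * ((V j)ᴴ * V k)))) =
    ∑ a, ((∑ k, B a k • V k) * ρ * (∑ k, B a k • V k)ᴴ -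
      (1/2 : ℂ) • ((∑ k, B a k • V k)ᴴ * (∑ k, B a k • V k) * ρ +
        ρ * ((∑ k, B a k • V k)ᴴ * (∑ k, B a k • V k)))) := by
  have hterm : ∀ a, ((∑ k, B a k • V k) * ρ * (∑ k, B a k • V k)ᴴ -
      (1/2 : ℂ) • ((∑ k, B a k • V k)ᴴ * (∑ k, B a k • V k) * ρ +
        ρ * ((∑ k, B a k • V k)ᴴ * (∑ k, B a k • V k)))) =
      ∑ j, ∑ k, (star (B a j) * B a k) •
        (V k * ρ * (V j)ᴴ - (1/2 : ℂ) • ((V j)ᴴ * V k * ρ + ρ * ((V j)ᴴ * V k))) := by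
    intro a
    have h1 : (∑ k, B a k • V k) * ρ * (∑ k, B a k • V k)ᴴ =
        ∑ j, ∑ k, (star (B a j) * B a k) • (V k * ρ * (V j)ᴴ) := by
      simp only [Matrix.conjTranspose_sum, Matrix.conjTranspose_smul, Finset.sum_mul,
        Finset.mul_sum, smul_mul_assoc, mul_smul_comm, smul_smul, Finset.smul_sum]
    have h2 : (∑ k, B a k • V k)ᴴ * (∑ k, B a k • V k) =
        ∑ j, ∑ k, (star (B a j) * B a k) • ((V j)ᴴ * V k) := by
      simp only [Matrix.conjTranspose_sum, Matrix.conjTranspose_smul, Finset.sum_mul,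
        Finset.mul_sum, smul_mul_assoc, mul_smul_comm, smul_smul, Finset.smul_sum]
      rw [Finset.sum_comm]
      simp only [mul_comm]
    rw [h1, h2]
    simp only [smul_sub, smul_add, Finset.sum_sub_distrib, Finset.sum_add_distrib,
      Finset.sum_mul, Finset.mul_sum, Finset.smul_sum, smul_mul_assoc, mul_smul_comm,
      smul_comm (1/2 : ℂ)]
  simp only [hterm, Matrix.mul_apply, Matrix.conjTranspose_apply, Finset.sum_smul]
  symm
  exact Finset.sum_comm.trans (Finset.sum_congr rfl fun j _ => Finset.sum_comm)

/-- The quadratic form of the Choi matrix of `Φ` at the (conjugated) vector of coefficients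
of `f`. -/
noncomputable def choiForm (f : Matrix (Fin 2) (Fin 2) ℂ →ₗ[ℂ] ℂ) :
    (Matrix (Fin 2) (Fin 2) ℂ →ₗ[ℂ] Matrix (Fin 2) (Fin 2) ℂ) →ₗ[ℂ] ℂ where
  toFun Φ := ∑ p : Fin 2 × Fin 2, ∑ q : Fin 2 × Fin 2,
    f (Matrix.single p.1 p.2 1) * Φ (Matrix.single p.2 q.2 1) p.1 q.1 *
      star (f (Matrix.single q.1 q.2 1))
  map_add' Φ Ψ := by simp [mul_add, add_mul, Finset.sum_add_distrib]
  map_smul' c Φ := by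
    simp only [LinearMap.smul_apply, Matrix.smul_apply, smul_eq_mul, RingHom.id_apply,
      Finset.mul_sum]
    refine Finset.sum_congr rfl fun p _ => Finset.sum_congr rfl fun q _ => ?_
    ring

theorem choiForm_apply (f : Matrix (Fin 2) (Fin 2) ℂ →ₗ[ℂ] ℂ)
    (Φ : Matrix (Fin 2) (Fin 2) ℂ →ₗ[ℂ] Matrix (Fin 2) (Fin 2) ℂ) :
    choiForm f Φ = ∑ p : Fin 2 × Fin 2, ∑ q : Fin 2 × Fin 2,
      f (Matrix.single p.1 p.2 1) * Φ (Matrix.single p.2 q.2 1) p.1 q.1 *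
        star (f (Matrix.single q.1 q.2 1)) := rfl

theorem linearMap_apply_eq_sum_single (f : Matrix (Fin 2) (Fin 2) ℂ →ₗ[ℂ] ℂ)
    (A : Matrix (Fin 2) (Fin 2) ℂ) :
    f A = ∑ p : Fin 2 × Fin 2, f (Matrix.single p.1 p.2 1) * A p.1 p.2 := by
  conv_lhs => rw [Matrix.matrix_eq_sum_single A]
  rw [Fintype.sum_prod_type, map_sum]
  refine Finset.sum_congr rfl fun i _ => ?_
  rw [map_sum]
  refine Finset.sum_congr rfl fun j _ => ?_
  have h : Matrix.single i j (A i j) = A i j • Matrix.single i j (1 : ℂ) := by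
    simp [Matrix.smul_single]
  rw [h, map_smul, smul_eq_mul, mul_comm]

theorem choiForm_mulLeftRight (f : Matrix (Fin 2) (Fin 2) ℂ →ₗ[ℂ] ℂ)
    (A B : Matrix (Fin 2) (Fin 2) ℂ) :
    choiForm f (LinearMap.mulLeftRight ℂ (A, Bᴴ)) = f A * star (f B) := by
  rw [linearMap_apply_eq_sum_single f A, linearMap_apply_eq_sum_single f B, star_sum,
    Finset.sum_mul_sum, choiForm_apply]
  refine Finset.sum_congr rfl fun p _ => Finset.sum_congr rfl fun q _ => ?_
  have h : (A * (Matrix.single p.2 q.2 1 : Matrix (Fin 2) (Fin 2) ℂ) * Bᴴ) p.1 q.1 =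
      A p.1 p.2 * star (B q.1 q.2) := by
    simp [Matrix.mul_apply, Matrix.single_apply, ite_and]
  rw [LinearMap.mulLeftRight_apply, h, star_mul]
  ring

theorem choiForm_nonneg (f : Matrix (Fin 2) (Fin 2) ℂ →ₗ[ℂ] ℂ)
    {Φ : Matrix (Fin 2) (Fin 2) ℂ →ₗ[ℂ] Matrix (Fin 2) (Fin 2) ℂ}
    (hΦ : IsCompletelyPositive Φ) : 0 ≤ choiForm f Φ := by
  let w : Fin 2 × Fin 2 → ℂ := fun p => if p.1 = p.2 then 1 else 0
  have hpos := (hΦ 2 _ (Matrix.posSemidef_vecMulVec_self_star w)).dotProduct_mulVec_nonneg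
    fun p => star (f (Matrix.single p.1 p.2 1))
  have hslice : ∀ a b : Fin 2, (Matrix.of fun i j =>
      Matrix.vecMulVec w (star w) (i, a) (j, b)) = Matrix.single a b (1 : ℂ) := by
    intro a b
    ext i j
    simp only [w, Matrix.of_apply, Matrix.vecMulVec_apply, Matrix.single_apply, Pi.star_apply,
      apply_ite star, star_one, star_zero, mul_ite, mul_one, mul_zero, ite_and]
    grind
  convert hpos using 1
  simp only [choiForm_apply, dotProduct, Matrix.mulVec, extTensor, hslice, Matrix.of_apply,
    Pi.star_apply, star_star, Finset.mul_sum, mul_assoc]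

theorem choiForm_id (f : Matrix (Fin 2) (Fin 2) ℂ →ₗ[ℂ] ℂ) :
    choiForm f LinearMap.id = f 1 * star (f 1) := by
  rw [← choiForm_mulLeftRight]
  congr 1
  ext1 ρ
  simp [LinearMap.mulLeftRight_apply]

theorem choiForm_dissipator {m : ℕ} (V : Fin m → Matrix (Fin 2) (Fin 2) ℂ)
    (K : Matrix (Fin m) (Fin m) ℂ)
    (D : Matrix (Fin 2) (Fin 2) ℂ →ₗ[ℂ] Matrix (Fin 2) (Fin 2) ℂ)
    (hD : ∀ ρ, D ρ = ∑ j, ∑ k, K j k •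
      (V k * ρ * (V j)ᴴ - (1/2 : ℂ) • ((V j)ᴴ * V k * ρ + ρ * ((V j)ᴴ * V k))))
    (f : Matrix (Fin 2) (Fin 2) ℂ →ₗ[ℂ] ℂ) (hf : f 1 = 0) :
    choiForm f D = ∑ j, ∑ k, K j k * (f (V k) * star (f (V j))) := by
  have hD' : D = ∑ j, ∑ k, K j k • (LinearMap.mulLeftRight ℂ (V k, (V j)ᴴ) -
      (1/2 : ℂ) • (LinearMap.mulLeftRight ℂ ((V j)ᴴ * V k, 1ᴴ) +
        LinearMap.mulLeftRight ℂ (1, (((V j)ᴴ * V k)ᴴ)ᴴ))) := by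
    refine LinearMap.ext fun ρ => ?_
    rw [hD, LinearMap.sum_apply]
    refine Finset.sum_congr rfl fun j _ => ?_
    rw [LinearMap.sum_apply]
    refine Finset.sum_congr rfl fun k _ => ?_
    simp only [LinearMap.smul_apply, LinearMap.sub_apply, LinearMap.add_apply,
      LinearMap.mulLeftRight_apply, Matrix.conjTranspose_conjTranspose,
      Matrix.conjTranspose_one, mul_one, one_mul]
  rw [hD']
  simp only [map_sum, map_smul, map_sub, map_add, choiForm_mulLeftRight, hf, star_zero, mul_zero,
    zero_mul, add_zero, sub_zero, smul_eq_mul]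

theorem LinearIndependent.exists_linearMap_apply_eq {𝕜 E ι : Type*} [Field 𝕜] [AddCommGroup E]
    [Module 𝕜 E] {v : ι → E} (hv : LinearIndependent 𝕜 v) (c : ι → 𝕜) :
    ∃ f : E →ₗ[𝕜] 𝕜, ∀ i, f (v i) = c i := by
  obtain ⟨f, hf⟩ := LinearMap.exists_extend ((Module.Basis.span hv).constr 𝕜 c)
  refine ⟨f, fun i => ?_⟩
  have h := (Module.Basis.span hv).constr_basis 𝕜 c i
  rw [← hf] at h
  simpa [Module.Basis.span_apply] using h

/-- A function vanishing at `0` and nonnegative on `[0, ∞)` has nonnegative derivative at `0`. -/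
theorem HasDerivAt.nonneg_of_forall_nonneg {g : ℝ → ℂ} {d : ℂ} (hg : HasDerivAt g d 0)
    (h0 : g 0 = 0) (h : ∀ t, 0 ≤ t → 0 ≤ g t) : 0 ≤ d := by
  have hlim := hg.tendsto_slope_zero_right
  refine ge_of_tendsto hlim (eventually_mem_nhdsWithin.mono fun t ht => ?_)
  rw [zero_add, h0, sub_zero]
  exact smul_nonneg (inv_nonneg.2 (le_of_lt ht)) (h t (le_of_lt ht))

open scoped MatrixOrder Matrix.Norms.L2Operator in
theorem Matrix.PosSemidef.exists_eq_conjTranspose_mul_self {n : Type*} [Fintype n] [DecidableEq n]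
    {K : Matrix n n ℂ} (hK : K.PosSemidef) : ∃ B : Matrix n n ℂ, K = Bᴴ * B :=
  CStarAlgebra.nonneg_iff_eq_star_mul_self.mp hK.nonneg

/-- GKS-type characterization: for a dissipator
`D(ρ) = Σ_{j,k} K_{jk} (V_k ρ V_j† − ½{V_j† V_k, ρ})` with linearly independent traceless `V_j`,
the generated semigroup `Λ t = e^{tD}` (characterized by `Λ 0 = id` and `Λ' = D ∘ Λ`)
consists of completely positive maps for all `t ≥ 0` if and only if the Kossakowski matrix `K`
is positive semidefinite; in particular if `K` is not positive semidefinite the semigroup is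
not completely positive. -/
theorem semigroup_completelyPositive_iff_kossakowski_posSemidef
    {m : ℕ} (V : Fin m → Matrix (Fin 2) (Fin 2) ℂ)
    (hVli : LinearIndependent ℂ V) (hVtr : ∀ j, (V j).trace = 0)
    (K : Matrix (Fin m) (Fin m) ℂ) (hK : K.IsHermitian)
    (D : Matrix (Fin 2) (Fin 2) ℂ →ₗ[ℂ] Matrix (Fin 2) (Fin 2) ℂ)
    (hD : ∀ ρ, D ρ = ∑ j, ∑ k, K j k •
      (V k * ρ * (V j)ᴴ - (1/2 : ℂ) • ((V j)ᴴ * V k * ρ + ρ * ((V j)ᴴ * V k))))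
    (Λ : ℝ → (Matrix (Fin 2) (Fin 2) ℂ →ₗ[ℂ] Matrix (Fin 2) (Fin 2) ℂ))
    (hΛ0 : Λ 0 = LinearMap.id)
    (hΛode : ∀ ρ, ∀ i j : Fin 2, ∀ t : ℝ,
      HasDerivAt (fun s => (Λ s ρ) i j) ((D (Λ t ρ)) i j) t) :
    ((¬ K.PosSemidef → ¬ ∀ t : ℝ, 0 ≤ t → IsCompletelyPositive (Λ t)) ∧
      (K.PosSemidef → ∀ t : ℝ, 0 ≤ t → IsCompletelyPositive (Λ t))) := by
  refine ⟨fun hKn hcp => hKn ?_, fun hKp t ht => ?_⟩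
  · refine Matrix.PosSemidef.of_dotProduct_mulVec_nonneg hK fun c => ?_
    obtain ⟨f₀, hf₀⟩ := hVli.exists_linearMap_apply_eq c
    let f : Matrix (Fin 2) (Fin 2) ℂ →ₗ[ℂ] ℂ :=
      f₀ - (f₀ 1 / 2) • Matrix.traceLinearMap (Fin 2) ℂ ℂ
    have hf1 : f 1 = 0 := by simp [f]
    have hfV : ∀ j, f (V j) = c j := fun j => by simp [f, hf₀, hVtr]
    have hderiv : HasDerivAt (fun t => choiForm f (Λ t)) (choiForm f (D ∘ₗ Λ 0)) 0 := by
      simp only [choiForm_apply]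
      exact HasDerivAt.fun_sum fun p _ => HasDerivAt.fun_sum fun q _ =>
        ((hΛode _ _ _ 0).const_mul _).mul_const _
    have hpos := hderiv.nonneg_of_forall_nonneg (by rw [hΛ0, choiForm_id, hf1, zero_mul])
      fun t ht => choiForm_nonneg f (hcp t ht)
    rw [hΛ0, LinearMap.comp_id, choiForm_dissipator V K D hD f hf1] at hpos
    convert hpos using 1
    simp only [dotProduct, Matrix.mulVec, Finset.mul_sum, hfV, Pi.star_apply]
    refine Finset.sum_congr rfl fun j _ => Finset.sum_congr rfl fun k _ => ?_
    ring
  · obtain ⟨B, rfl⟩ := hKp.exists_eq_conjTranspose_mul_self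
    exact extTensor_posSemidef_of_perturbation D _ Λ hΛ0 hΛode (fun s hs =>
      isCompletelyPositive_id_add_dissipator (fun a => ∑ k, B a k • V k) D
        (fun ρ => (hD ρ).trans (dissipator_eq_sum_of_gram V B ρ)) hs) ht
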